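/- arXiv:1502.06284 — 2 statements merged into one kernel-verified Lean document; each statement's English description precedes it below -/
import Mathlib

section
/- There exists an absolute constant C > 0 with the following property (discrete gradient estimate for harmonic functions): for every real R > 1 and every function f, defined and nonnegative on the discrete ball B_R = {v ∈ ℤ² : |v| < R} and discrete harmonic at every v ∈ ℤ² with |v| < R − 1 (i.e. Δf(v) = 0 there), one has |f(1,0) − f(0,0)| ≤ (C / R) · max_{|v| < R} f(v). -/
/-- The discrete Laplacian on `ℤ × ℤ` for real-valued functions: sum over the four grid
neighbors minus `4` times the value at the point. -/
def lapR (H : ℤ × ℤ → ℝ) (v : ℤ × ℤ) : ℝ :=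
  H (v.1 + 1, v.2) + H (v.1 - 1, v.2) + H (v.1, v.2 + 1) + H (v.1, v.2 - 1) - 4 * H v

/-- The Euclidean norm of a point of `ℤ²`. -/
noncomputable def enorm2 (v : ℤ × ℤ) : ℝ :=
  Real.sqrt ((v.1 : ℝ) ^ 2 + (v.2 : ℝ) ^ 2)

/-- Barrier argument on the half square, after reflecting across the line `x = 1/2`. -/
lemma half_square_bound (K : ℤ) (hK : 1 ≤ K) (f : ℤ × ℤ → ℝ) (M : ℝ) (hM : 0 < M)
    (h0 : ∀ x y : ℤ, -K ≤ x → x ≤ K → -K ≤ y → y ≤ K → 0 ≤ f (x, y))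
    (h1 : ∀ x y : ℤ, -K ≤ x → x ≤ K → -K ≤ y → y ≤ K → f (x, y) ≤ M)
    (hl : ∀ x y : ℤ, -K < x → x < K → -K < y → y < K → lapR f (x, y) = 0) :
    (K : ℝ) * (f (1, 0) - f (0, 0)) ≤ 3 / 2 * M := by
  have hKR : (1 : ℝ) ≤ K := by exact_mod_cast hK
  obtain ⟨w, hw⟩ : ∃ w : ℤ → ℤ → ℝ, ∀ x y, w x y =
      M * (3 * K * ((x : ℝ) - 1 / 2) + (y : ℝ) ^ 2 - 2 * ((x : ℝ) - 1 / 2) ^ 2 + 1 / 2)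
        - (K : ℝ) ^ 2 * (f (x, y) - f (1 - x, y)) := ⟨_, fun _ _ => rfl⟩
  have hne : (Finset.Icc 1 K ×ˢ Finset.Icc (-K) K).Nonempty :=
    ⟨(1, 0), by simp; omega⟩
  obtain ⟨⟨a, b⟩, hmem, hmin⟩ := Finset.exists_min_image _ (fun p : ℤ × ℤ => w p.1 p.2) hne
  simp only [Finset.mem_product, Finset.mem_Icc] at hmem
  obtain ⟨⟨ha1, haK⟩, hbK', hbK⟩ := hmem
  have hmin' : ∀ x y : ℤ, 1 ≤ x → x ≤ K → -K ≤ y → y ≤ K → w a b ≤ w x y := by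
    intro x y q1 q2 q3 q4
    exact hmin (x, y) (by simp only [Finset.mem_product, Finset.mem_Icc]; exact ⟨⟨q1, q2⟩, q3, q4⟩)
  have haR : (1 : ℝ) ≤ a := by exact_mod_cast ha1
  have haKR : (a : ℝ) ≤ K := by exact_mod_cast haK
  have key : 0 ≤ w a b := by
    have hg : f (a, b) - f (1 - a, b) ≤ M := by
      have := h1 a b (by omega) haK hbK' hbK
      have := h0 (1 - a) b (by omega) (by omega) hbK' hbK
      linarith
    have bd : (K : ℝ) ^ 2 ≤ 3 * K * ((a : ℝ) - 1 / 2) + (b : ℝ) ^ 2 - 2 * ((a : ℝ) - 1 / 2) ^ 2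
        + 1 / 2 → 0 ≤ w a b := by
      intro h
      rw [hw]
      have e1 := mul_le_mul_of_nonneg_left h hM.le
      have e2 := mul_le_mul_of_nonneg_left hg (sq_nonneg (K : ℝ))
      linarith
    by_cases c1 : b = K ∨ b = -K
    · apply bd
      have : (b : ℝ) ^ 2 = (K : ℝ) ^ 2 := by
        rcases c1 with c | c <;> rw [c] <;> push_cast <;> ring
      rw [this]
      nlinarith
    by_cases c2 : a = K
    · apply bd
      rw [c2]
      nlinarith [sq_nonneg (b : ℝ)]
    push Not at c1
    have i1 : a < K := by omega
    have i2 : b < K := by omega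
    have i3 : -K < b := by omega
    have l1 := hl a b (by omega) i1 i3 i2
    have l2 := hl (1 - a) b (by omega) (by omega) i3 i2
    simp only [lapR] at l1 l2
    have s1 : (1 - a + 1 : ℤ) = 1 - (a - 1) := by ring
    have s2 : (1 - a - 1 : ℤ) = 1 - (a + 1) := by ring
    rw [s1, s2] at l2
    have lw : w (a + 1) b + w (a - 1) b + w a (b + 1) + w a (b - 1) - 4 * w a b = -2 * M := by
      simp only [hw]
      push_cast
      linear_combination (-(K : ℝ) ^ 2) * l1 + (K : ℝ) ^ 2 * l2
    have m1 := hmin' (a + 1) b (by omega) (by omega) (by omega) (by omega)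
    have m2 := hmin' a (b + 1) (by omega) (by omega) (by omega) (by omega)
    have m3 := hmin' a (b - 1) (by omega) (by omega) (by omega) (by omega)
    by_cases c3 : a = 1
    · subst c3
      have : 0 ≤ w (1 - 1) b + w 1 b := by
        simp only [hw]
        norm_num
        nlinarith [mul_nonneg hM.le (sq_nonneg (b : ℝ))]
      linarith
    · have m4 := hmin' (a - 1) b (by omega) (by omega) (by omega) (by omega)
      linarith
  have fin := key.trans (hmin' 1 0 le_rfl hK (by omega) (by omega))
  rw [hw] at fin
  norm_num at fin
  have : (K : ℝ) * (K * (f (1, 0) - f (0, 0))) ≤ K * (3 / 2 * M) := by nlinarith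
  exact le_of_mul_le_mul_left this (by linarith)

lemma enorm2_lt {x y k : ℤ} {r : ℝ} (hk : 0 ≤ k) (hr : 0 < r) (hkr : 2 * (k : ℝ) ≤ r)
    (x1 : -k ≤ x) (x2 : x ≤ k) (y1 : -k ≤ y) (y2 : y ≤ k) : enorm2 (x, y) < r := by
  have a1 : -(k : ℝ) ≤ x := by exact_mod_cast x1
  have a2 : (x : ℝ) ≤ k := by exact_mod_cast x2
  have b1 : -(k : ℝ) ≤ y := by exact_mod_cast y1
  have b2 : (y : ℝ) ≤ k := by exact_mod_cast y2
  have k0 : (0 : ℝ) ≤ k := by exact_mod_cast hk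
  have ex : (x : ℝ) ^ 2 ≤ (k : ℝ) ^ 2 := sq_le_sq' a1 a2
  have ey : (y : ℝ) ^ 2 ≤ (k : ℝ) ^ 2 := sq_le_sq' b1 b2
  unfold enorm2
  rw [Real.sqrt_lt' hr]
  simp only
  nlinarith

/-- Discrete gradient estimate (Duffin): there is an absolute constant `C > 0` such that
any function nonnegative on the discrete ball of radius `R > 1` and discrete harmonic at
all points of norm `< R − 1` satisfies `|f(1,0) − f(0,0)| ≤ (C/R) · max_{|v|<R} f(v)`
(expressed via an arbitrary upper bound `M` of `f` on the ball). -/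
theorem discrete_harmonic_gradient_estimate :
    ∃ C : ℝ, 0 < C ∧ ∀ R : ℝ, 1 < R → ∀ f : ℤ × ℤ → ℝ,
      (∀ v, enorm2 v < R → 0 ≤ f v) →
      (∀ v, enorm2 v < R - 1 → lapR f v = 0) →
      ∀ M : ℝ, (∀ v, enorm2 v < R → f v ≤ M) →
        |f (1, 0) - f (0, 0)| ≤ (C / R) * M := by
  refine ⟨6, by norm_num, ?_⟩
  intro R hR f h0 hl M h1
  have z0 : enorm2 (0, 0) < R := enorm2_lt (k := 0) le_rfl (by linarith) (by simp; linarith)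
    (by simp) (by simp) (by simp) (by simp)
  have z1 : enorm2 (1, 0) < R := by simp [enorm2]; exact hR
  have f0 := h0 _ z0
  have f1 := h0 _ z1
  have g0 := h1 _ z0
  have g1 := h1 _ z1
  have hR0 : 0 < R := by linarith
  rw [div_mul_eq_mul_div, le_div_iff₀ hR0]
  rcases (f0.trans g0).eq_or_lt with hM | hM
  · have : f (1, 0) - f (0, 0) = 0 := by linarith
    rw [this, ← hM]; simp
  have hd : |f (1, 0) - f (0, 0)| ≤ M := abs_le.2 ⟨by linarith, by linarith⟩
  by_cases hR2 : R < 2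
  · nlinarith [abs_nonneg (f (1, 0) - f (0, 0))]
  push Not at hR2
  obtain ⟨K, hKdef⟩ : ∃ K : ℤ, K = ⌊R / 2⌋ := ⟨_, rfl⟩
  have hK : 1 ≤ K := by rw [hKdef, Int.le_floor]; push_cast; linarith
  have hK1 : (K : ℝ) ≤ R / 2 := by rw [hKdef]; exact Int.floor_le _
  have hK2 : R / 2 < K + 1 := by rw [hKdef]; exact Int.lt_floor_add_one _
  have hKR : (1 : ℝ) ≤ K := by exact_mod_cast hK
  have inball : ∀ x y : ℤ, -K ≤ x → x ≤ K → -K ≤ y → y ≤ K → enorm2 (x, y) < R :=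
    fun x y q1 q2 q3 q4 => enorm2_lt (by omega) hR0 (by linarith) q1 q2 q3 q4
  have inint : ∀ x y : ℤ, -K < x → x < K → -K < y → y < K → enorm2 (x, y) < R - 1 :=
    fun x y q1 q2 q3 q4 => enorm2_lt (k := K - 1) (by omega) (by linarith)
      (by push_cast; linarith) (by omega) (by omega) (by omega) (by omega)
  have A := half_square_bound K hK f M hM
    (fun x y q1 q2 q3 q4 => h0 _ (inball x y q1 q2 q3 q4))
    (fun x y q1 q2 q3 q4 => h1 _ (inball x y q1 q2 q3 q4))
    (fun x y q1 q2 q3 q4 => hl _ (inint x y q1 q2 q3 q4))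
  have B := half_square_bound K hK (fun v => M - f v) M hM
    (fun x y q1 q2 q3 q4 => by have := h1 _ (inball x y q1 q2 q3 q4); simpa using this)
    (fun x y q1 q2 q3 q4 => by have := h0 _ (inball x y q1 q2 q3 q4); simpa using this)
    (fun x y q1 q2 q3 q4 => by
      have := hl _ (inint x y q1 q2 q3 q4)
      simp only [lapR] at this ⊢
      linarith)
  have D : (K : ℝ) * |f (1, 0) - f (0, 0)| ≤ 3 / 2 * M := by
    rcases abs_cases (f (1, 0) - f (0, 0)) with ⟨h, _⟩ | ⟨h, _⟩ <;> rw [h]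
    · exact A
    · linarith
  have : |f (1, 0) - f (0, 0)| * R ≤ |f (1, 0) - f (0, 0)| * (4 * K) :=
    mul_le_mul_of_nonneg_left (by linarith) (abs_nonneg _)
  linarith
end

section
/- For every c > 0 there exists C > 0 such that for all real R ≥ 2 the following holds: if u : ℤ² → ℤ is integer-valued, satisfies Δu(v) = 0 for every v ∈ ℤ² with |v| < C·R, and |u(v)| ≤ c·R for every v ∈ ℤ² with |v| ≤ C·R, then u agrees on the ball {v ∈ ℤ² : |v| ≤ R} with an affine function, i.e. there exist integers a, b, d with u(x, y) = a·x + b·y + d for all (x, y) ∈ ℤ² with |(x, y)| ≤ R. -/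
/-- The discrete Laplacian on `ℤ × ℤ`: sum over the four grid neighbors minus `4` times
the value at the point. -/
def lap (H : ℤ × ℤ → ℤ) (v : ℤ × ℤ) : ℤ :=
  H (v.1 + 1, v.2) + H (v.1 - 1, v.2) + H (v.1, v.2 + 1) + H (v.1, v.2 - 1) - 4 * H v

/-- Maximum principle on the rotated rectangle `0 ≤ x - y ≤ r`, `|x + y| ≤ r`. -/
theorem max_principle (r : ℤ) (f : ℤ → ℤ → ℝ)
    (harm : ∀ x y, 0 < x - y → x - y < r → -r < x + y → x + y < r →
      f (x + 1) y + f (x - 1) y + f x (y + 1) + f x (y - 1) = 4 * f x y)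
    (bd : ∀ x y, 0 ≤ x - y → x - y ≤ r → -r ≤ x + y → x + y ≤ r →
      (x - y = 0 ∨ x - y = r ∨ x + y = r ∨ x + y = -r) → 0 ≤ f x y)
    (a b : ℤ) (h1 : 0 ≤ a - b) (h2 : a - b ≤ r) (h3 : -r ≤ a + b) (h4 : a + b ≤ r) :
    0 ≤ f a b := by
  classical
  let K : Finset (ℤ × ℤ) := (Finset.Icc (-r) r ×ˢ Finset.Icc (-r) r).filter
    (fun v => 0 ≤ v.1 - v.2 ∧ v.1 - v.2 ≤ r ∧ -r ≤ v.1 + v.2 ∧ v.1 + v.2 ≤ r)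
  have hK : ∀ x y, (x, y) ∈ K ↔ (0 ≤ x - y ∧ x - y ≤ r ∧ -r ≤ x + y ∧ x + y ≤ r) := by
    intro x y
    simp only [K, Finset.mem_filter, Finset.mem_product, Finset.mem_Icc]
    constructor
    · exact fun h => h.2
    · intro h
      refine ⟨?_, h⟩
      omega
  have hab : (a, b) ∈ K := (hK a b).2 ⟨h1, h2, h3, h4⟩
  obtain ⟨⟨m, n⟩, hmK, hm⟩ := Finset.exists_min_image K (fun v => f v.1 v.2) ⟨_, hab⟩
  simp only at hm
  by_contra hneg
  have hneg' : f m n < 0 := lt_of_le_of_lt (hm _ hab) (not_le.1 hneg)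
  let L : Finset (ℤ × ℤ) := K.filter (fun v => f v.1 v.2 = f m n)
  have hL : (m, n) ∈ L := by simp [L, hmK]
  obtain ⟨⟨x, y⟩, hxL, hx⟩ := Finset.exists_min_image L (fun v => v.1 - v.2) ⟨_, hL⟩
  simp only at hx
  have hxL' : (x, y) ∈ K ∧ f x y = f m n := by simpa [L] using hxL
  obtain ⟨hxK, hxe⟩ := hxL'
  have hxk := (hK x y).1 hxK
  have hint : 0 < x - y ∧ x - y < r ∧ -r < x + y ∧ x + y < r := by
    by_contra hb
    have := bd x y hxk.1 hxk.2.1 hxk.2.2.1 hxk.2.2.2 (by omega)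
    linarith
  have e := harm x y hint.1 hint.2.1 hint.2.2.1 hint.2.2.2
  have k2 : (x - 1, y) ∈ K := (hK _ _).2 (by omega)
  have n1 := hm (x + 1, y) ((hK _ _).2 (by omega))
  have n2 := hm (x - 1, y) k2
  have n3 := hm (x, y + 1) ((hK _ _).2 (by omega))
  have n4 := hm (x, y - 1) ((hK _ _).2 (by omega))
  simp only at n1 n2 n3 n4
  have e2 : f (x - 1) y = f m n := by linarith
  have := hx (x - 1, y) (by simp [L, k2, e2])
  simp only at this
  omega

/-- Gradient estimate across the diagonal, by reflection and an explicit barrier. -/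
theorem diag_le (r : ℤ) (hr : 1 ≤ r) (M : ℝ) (hM : 4 * M < r) (u : ℤ → ℤ → ℤ)
    (harm : ∀ x y, x ^ 2 + y ^ 2 < r ^ 2 →
      u (x + 1) y + u (x - 1) y + u x (y + 1) + u x (y - 1) = 4 * u x y)
    (bdd : ∀ x y, x ^ 2 + y ^ 2 ≤ r ^ 2 → |(u x y : ℝ)| ≤ M) :
    u 1 0 ≤ u 0 1 := by
  have hM0 : 0 ≤ M := le_trans (abs_nonneg _) (bdd 0 0 (by positivity))
  have hr' : (1 : ℝ) ≤ r := by exact_mod_cast hr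
  have key := max_principle r
    (fun x y => 2 * M * (4 * x * y + 2 * r * (x - y)) - (r : ℝ) ^ 2 * ((u x y : ℝ) - u y x))
    (by
      intro x y h1 h2 h3 h4
      have hn : x ^ 2 + y ^ 2 < r ^ 2 := by nlinarith
      have e1 : ((u (x + 1) y : ℝ) + u (x - 1) y + u x (y + 1) + u x (y - 1)) = 4 * u x y := by
        exact_mod_cast harm x y hn
      have e2 : ((u (y + 1) x : ℝ) + u (y - 1) x + u y (x + 1) + u y (x - 1)) = 4 * u y x := by
        exact_mod_cast harm y x (by linarith)
      push_cast
      linear_combination (-(r : ℝ) ^ 2) * e1 + (r : ℝ) ^ 2 * e2)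
    (by
      intro x y h1 h2 h3 h4 h
      have hn : x ^ 2 + y ^ 2 ≤ r ^ 2 := by nlinarith
      have b1 := abs_le.1 (bdd x y hn)
      have b2 := abs_le.1 (bdd y x (by linarith))
      by_cases hd : x - y = 0
      · have : x = y := by omega
        subst this
        have : 0 ≤ 2 * M * (4 * (x : ℝ) ^ 2) := by positivity
        nlinarith
      · have hphi : r ^ 2 ≤ 4 * x * y + 2 * r * (x - y) := by
          have e : 4 * x * y = (x + y) ^ 2 - (x - y) ^ 2 := by ring
          rw [e]
          rcases h with h | h | h | h
          · exact absurd h hd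
          · rw [h]; nlinarith [sq_nonneg (x + y)]
          · rw [h]; nlinarith
          · rw [h]; nlinarith
        have hphi' : (r : ℝ) ^ 2 ≤ 4 * x * y + 2 * r * (x - y) := by exact_mod_cast hphi
        have q1 := mul_le_mul_of_nonneg_left hphi' (by linarith : 0 ≤ 2 * M)
        have q2 : (r : ℝ) ^ 2 * ((u x y : ℝ) - u y x) ≤ (r : ℝ) ^ 2 * (2 * M) :=
          mul_le_mul_of_nonneg_left (by linarith) (by positivity)
        linarith)
    1 0 (by omega) (by omega) (by omega) (by omega)
  push_cast at key
  by_contra hlt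
  have h1 : u 0 1 + 1 ≤ u 1 0 := by omega
  have h1' : (1 : ℝ) ≤ (u 1 0 : ℝ) - u 0 1 := by
    have : ((u 0 1 : ℝ) + 1) ≤ u 1 0 := by exact_mod_cast h1
    linarith
  nlinarith [mul_le_mul_of_nonneg_left h1' (sq_nonneg (r : ℝ)),
    mul_lt_mul_of_pos_left hM (by linarith : (0 : ℝ) < r)]

theorem diag_eq (r : ℤ) (hr : 1 ≤ r) (M : ℝ) (hM : 4 * M < r) (u : ℤ → ℤ → ℤ)
    (harm : ∀ x y, x ^ 2 + y ^ 2 < r ^ 2 →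
      u (x + 1) y + u (x - 1) y + u x (y + 1) + u x (y - 1) = 4 * u x y)
    (bdd : ∀ x y, x ^ 2 + y ^ 2 ≤ r ^ 2 → |(u x y : ℝ)| ≤ M) :
    u 1 0 = u 0 1 := by
  refine le_antisymm (diag_le r hr M hM u harm bdd) ?_
  refine diag_le r hr M hM (fun x y => u y x) ?_ ?_
  · intro x y h
    have := harm y x (by linarith)
    linarith
  · intro x y h
    exact bdd y x (by linarith)

theorem nbr_eq (r : ℤ) (hr : 1 ≤ r) (M : ℝ) (hM : 4 * M < r) (u : ℤ → ℤ → ℤ)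
    (harm : ∀ x y, x ^ 2 + y ^ 2 < r ^ 2 →
      u (x + 1) y + u (x - 1) y + u x (y + 1) + u x (y - 1) = 4 * u x y)
    (bdd : ∀ x y, x ^ 2 + y ^ 2 ≤ r ^ 2 → |(u x y : ℝ)| ≤ M) :
    u 1 0 = u 0 0 ∧ u (-1) 0 = u 0 0 ∧ u 0 1 = u 0 0 ∧ u 0 (-1) = u 0 0 := by
  have a1 := diag_eq r hr M hM u harm bdd
  have a2 := diag_eq r hr M hM (fun x y => u (-x) y)
    (by
      intro x y h
      have := harm (-x) y (by linarith [neg_sq x])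
      rw [show -(x + 1) = -x - 1 by ring, show -(x - 1) = -x + 1 by ring]
      linarith)
    (fun x y h => bdd (-x) y (by linarith [neg_sq x]))
  have a3 := diag_eq r hr M hM (fun x y => u x (-y))
    (by
      intro x y h
      have := harm x (-y) (by linarith [neg_sq y])
      rw [show -(y + 1) = -y - 1 by ring, show -(y - 1) = -y + 1 by ring]
      linarith)
    (fun x y h => bdd x (-y) (by linarith [neg_sq y]))
  have h0 := harm 0 0 (by nlinarith)
  simp at a1 a2 a3 h0
  omega

theorem enorm2_add_le (a b x y : ℤ) :
    enorm2 (a + x, b + y) ≤ enorm2 (a, b) + enorm2 (x, y) := by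
  unfold enorm2
  simp only
  push_cast
  have hA := Real.sqrt_nonneg ((a : ℝ) ^ 2 + (b : ℝ) ^ 2)
  have hB := Real.sqrt_nonneg ((x : ℝ) ^ 2 + (y : ℝ) ^ 2)
  have hA2 := Real.sq_sqrt (by positivity : 0 ≤ (a : ℝ) ^ 2 + (b : ℝ) ^ 2)
  have hB2 := Real.sq_sqrt (by positivity : 0 ≤ (x : ℝ) ^ 2 + (y : ℝ) ^ 2)
  refine Real.sqrt_le_iff.2 ⟨by linarith, ?_⟩
  have hc : (a : ℝ) * x + b * y ≤
      Real.sqrt ((a : ℝ) ^ 2 + (b : ℝ) ^ 2) * Real.sqrt ((x : ℝ) ^ 2 + (y : ℝ) ^ 2) := by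
    rw [← Real.sqrt_mul (by positivity)]
    apply Real.le_sqrt_of_sq_le
    nlinarith [sq_nonneg ((a : ℝ) * y - b * x)]
  nlinarith

theorem const_of_steps (u : ℤ × ℤ → ℤ) (R : ℝ)
    (hs : ∀ a b : ℤ, enorm2 (a, b) ≤ R → u (a + 1, b) = u (a, b) ∧ u (a - 1, b) = u (a, b) ∧
      u (a, b + 1) = u (a, b) ∧ u (a, b - 1) = u (a, b)) :
    ∀ (n : ℕ) (a b : ℤ), a.natAbs + b.natAbs = n → enorm2 (a, b) ≤ R →
      u (a, b) = u (0, 0) := by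
  have mono : ∀ a b a' b' : ℤ, |a'| ≤ |a| → |b'| ≤ |b| → enorm2 (a, b) ≤ R →
      enorm2 (a', b') ≤ R := by
    intro a b a' b' h1 h2 h
    refine le_trans ?_ h
    unfold enorm2
    apply Real.sqrt_le_sqrt
    have h1' := sq_le_sq.2 h1
    have h2' := sq_le_sq.2 h2
    simp only
    exact_mod_cast add_le_add h1' h2'
  intro n
  induction n with
  | zero =>
    intro a b h _
    have ha : a = 0 := by omega
    have hb : b = 0 := by omega
    rw [ha, hb]
  | succ k ih =>
    intro a b h hR
    obtain ⟨s1, s2, s3, s4⟩ := hs a b hR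
    rcases lt_trichotomy a 0 with ha | ha | ha
    · rw [← s1]
      exact ih _ _ (by omega) (mono a b _ _ (sq_le_sq.1 (by nlinarith)) le_rfl hR)
    · rcases lt_trichotomy b 0 with hb | hb | hb
      · rw [← s3]
        exact ih _ _ (by omega) (mono a b _ _ le_rfl (sq_le_sq.1 (by nlinarith)) hR)
      · omega
      · rw [← s4]
        exact ih _ _ (by omega) (mono a b _ _ le_rfl (sq_le_sq.1 (by nlinarith)) hR)
    · rw [← s2]
      exact ih _ _ (by omega) (mono a b _ _ (sq_le_sq.1 (by nlinarith)) le_rfl hR)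

/-- An integer-valued function which is discrete harmonic on a ball of radius `C·R` and
bounded by `c·R` there is affine (with integer coefficients) on the ball of radius `R`. -/
theorem integer_harmonic_linear_bound :
    ∀ c : ℝ, 0 < c → ∃ C : ℝ, 0 < C ∧ ∀ R : ℝ, 2 ≤ R →
      ∀ u : ℤ × ℤ → ℤ,
        (∀ v, enorm2 v < C * R → lap u v = 0) →
        (∀ v, enorm2 v ≤ C * R → (|u v| : ℝ) ≤ c * R) →
        ∃ a b d : ℤ, ∀ v : ℤ × ℤ, enorm2 v ≤ R →
          u v = a * v.1 + b * v.2 + d := by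
  intro c hc
  refine ⟨4 * c + 3, by linarith, ?_⟩
  intro R hR u harm bdd
  refine ⟨0, 0, u (0, 0), ?_⟩
  have hr1 : (⌊(4 * c + 2) * R⌋ : ℝ) ≤ (4 * c + 2) * R := Int.floor_le _
  have hr2 : (4 * c + 2) * R < ⌊(4 * c + 2) * R⌋ + 1 := Int.lt_floor_add_one _
  generalize ⌊(4 * c + 2) * R⌋ = r at hr1 hr2
  have hcR : 0 < c * R := by positivity
  have hr3 : (1 : ℝ) < r := by nlinarith
  have hr : 1 ≤ r := by
    have : 1 < r := by exact_mod_cast hr3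
    omega
  have hM : 4 * (c * R) < r := by nlinarith
  have steps : ∀ a b : ℤ, enorm2 (a, b) ≤ R → u (a + 1, b) = u (a, b) ∧
      u (a - 1, b) = u (a, b) ∧ u (a, b + 1) = u (a, b) ∧ u (a, b - 1) = u (a, b) := by
    intro a b hab
    have := nbr_eq r hr (c * R) hM (fun x y => u (a + x, b + y))
      (by
        intro x y h
        have hlt : enorm2 (x, y) < r := by
          unfold enorm2
          rw [Real.sqrt_lt' (by linarith)]
          simp only
          exact_mod_cast h
        have := harm (a + x, b + y) (by
          have := enorm2_add_le a b x y
          nlinarith)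
        unfold lap at this
        simp only [add_assoc, add_sub_assoc] at this ⊢
        linarith)
      (by
        intro x y h
        have hlt : enorm2 (x, y) ≤ r := by
          unfold enorm2
          apply Real.sqrt_le_iff.2 ⟨by linarith, ?_⟩
          simp only
          exact_mod_cast h
        have := bdd (a + x, b + y) (by
          have := enorm2_add_le a b x y
          nlinarith)
        simpa using this)
    simpa [sub_eq_add_neg] using this
  rintro ⟨a, b⟩ h
  simpa using const_of_steps u R steps _ a b rfl h
end
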